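/- Every K-algebra endomorphism of I_1 is injective. -/

import Mathlib

set_option linter.unusedSectionVars false

open Polynomial

noncomputable section

variable (K : Type*) [Field K] [CharZero K]

/-- Formal differentiation `∂` as a `K`-linear endomorphism of `K[x]`. -/
def derOp : Module.End K (Polynomial K) := Polynomial.derivative

/-- Multiplication by `x` as a `K`-linear endomorphism of `K[x]`. -/
def xOp : Module.End K (Polynomial K) := LinearMap.mulLeft K (Polynomial.X : Polynomial K)

/-- Integration `∫`: the unique `K`-linear map with `∫ xⁿ = xⁿ⁺¹/(n+1)`. -/
def intOp : Module.End K (Polynomial K) :=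
  Polynomial.lsum fun n => ((n : K) + 1)⁻¹ • Polynomial.monomial (n + 1)

/-- The algebra `I₁` of polynomial integro-differential operators: the unital
`K`-subalgebra of `End_K K[x]` generated by `X`, `∂` and `∫`. -/
def I1 : Subalgebra K (Module.End K (Polynomial K)) :=
  Algebra.adjoin K {xOp K, derOp K, intOp K}

/-- `H := ∂ ∘ X`. -/
def Hop : Module.End K (Polynomial K) := derOp K * xOp K

/-- `e_{ij} := ∫^i ∂^j - ∫^{i+1} ∂^{j+1}`. -/
def eOp (i j : ℕ) : Module.End K (Polynomial K) :=
  intOp K ^ i * derOp K ^ j - intOp K ^ (i + 1) * derOp K ^ (j + 1)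

/-- `F`, the `K`-linear span of the `e_{ij}`. -/
def Fspan : Submodule K (Module.End K (Polynomial K)) :=
  Submodule.span K (Set.range fun p : ℕ × ℕ => eOp K p.1 p.2)

lemma xOp_mem : xOp K ∈ I1 K := Algebra.subset_adjoin (by simp)
lemma derOp_mem : derOp K ∈ I1 K := Algebra.subset_adjoin (by simp)
lemma intOp_mem : intOp K ∈ I1 K := Algebra.subset_adjoin (by simp)
lemma Hop_mem : Hop K ∈ I1 K := mul_mem (derOp_mem K) (xOp_mem K)
lemma eOp_mem (i j : ℕ) : eOp K i j ∈ I1 K :=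
  sub_mem (mul_mem (pow_mem (intOp_mem K) i) (pow_mem (derOp_mem K) j))
    (mul_mem (pow_mem (intOp_mem K) (i + 1)) (pow_mem (derOp_mem K) (j + 1)))

/-- `H` as an element of `I₁`. -/
def HelI : I1 K := ⟨Hop K, Hop_mem K⟩
/-- `∂` as an element of `I₁`. -/
def DelI : I1 K := ⟨derOp K, derOp_mem K⟩
/-- `∫` as an element of `I₁`. -/
def IntI : I1 K := ⟨intOp K, intOp_mem K⟩


/-- divided power basis -/
def bb (n : ℕ) : K[X] := monomial n ((n.factorial : K)⁻¹)

/-- coordinate functional -/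
def cf (m : ℕ) : K[X] →ₗ[K] K := (m.factorial : K) • Polynomial.lcoeff K m

lemma cf_apply (m : ℕ) (f : K[X]) : cf K m f = (m.factorial : K) * f.coeff m := by
  simp [cf]

lemma fac_ne (m : ℕ) : (m.factorial : K) ≠ 0 := by
  exact_mod_cast m.factorial_ne_zero

lemma cf_ext {f g : K[X]} (h : ∀ m, cf K m f = cf K m g) : f = g := by
  ext m
  have := h m
  rw [cf_apply, cf_apply] at this
  exact mul_left_cancel₀ (fac_ne K m) this

lemma cf_bb (m n : ℕ) : cf K m (bb K n) = if m = n then 1 else 0 := by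
  rw [cf_apply, bb, coeff_monomial]
  by_cases h : n = m
  · subst h; simpa using mul_inv_cancel₀ (fac_ne K n)
  · simp [h, Ne.symm h]

lemma cf_der (m : ℕ) (f : K[X]) : cf K m (derOp K f) = cf K (m + 1) f := by
  rw [cf_apply, cf_apply]
  show _ * (derivative f).coeff m = _
  rw [coeff_derivative, Nat.factorial_succ]
  push_cast
  ring

lemma coeff_int_succ (m : ℕ) (f : K[X]) :
    (intOp K f).coeff (m + 1) = ((m : K) + 1)⁻¹ * f.coeff m := by
  induction f using Polynomial.induction_on' with
  | add p q hp hq => rw [map_add, coeff_add, hp, hq, coeff_add]; ring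
  | monomial n a =>
    simp only [intOp, lsum_apply]
    rw [sum_monomial_index _ _ (by simp)]
    by_cases h : n = m
    · subst h; simp
    · simp [coeff_monomial, h]

lemma coeff_int_zero (f : K[X]) : (intOp K f).coeff 0 = 0 := by
  induction f using Polynomial.induction_on' with
  | add p q hp hq => rw [map_add, coeff_add, hp, hq, add_zero]
  | monomial n a =>
    simp only [intOp, lsum_apply]
    rw [sum_monomial_index _ _ (by simp)]
    simp [coeff_monomial]

lemma cf_int_succ (m : ℕ) (f : K[X]) : cf K (m + 1) (intOp K f) = cf K m f := by
  rw [cf_apply, cf_apply, coeff_int_succ, Nat.factorial_succ]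
  have : (m : K) + 1 ≠ 0 := by exact_mod_cast m.succ_ne_zero
  push_cast
  field_simp

lemma cf_int_zero (f : K[X]) : cf K 0 (intOp K f) = 0 := by
  rw [cf_apply, coeff_int_zero, mul_zero]

lemma cf_x_succ (m : ℕ) (f : K[X]) : cf K (m + 1) (xOp K f) = ((m : K) + 1) * cf K m f := by
  rw [cf_apply, cf_apply]
  show _ * (X * f).coeff (m + 1) = _
  rw [coeff_X_mul, Nat.factorial_succ]
  push_cast
  ring

lemma cf_x_zero (f : K[X]) : cf K 0 (xOp K f) = 0 := by
  rw [cf_apply]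
  show _ * (X * f).coeff 0 = _
  simp

lemma int_bb (n : ℕ) : intOp K (bb K n) = bb K (n + 1) := by
  apply cf_ext
  rintro (_ | m)
  · rw [cf_int_zero, cf_bb]; simp
  · rw [cf_int_succ, cf_bb, cf_bb]; simp

lemma int_pow_bb (n : ℕ) : (intOp K ^ n) (bb K 0) = bb K n := by
  induction n with
  | zero => simp
  | succ n ih => rw [pow_succ', Module.End.mul_apply, ih, int_bb]

lemma cf_der_pow (m j : ℕ) (f : K[X]) : cf K j ((derOp K ^ m) f) = cf K (j + m) f := by
  induction m generalizing j with
  | zero => simp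
  | succ m ih =>
    rw [pow_succ', Module.End.mul_apply, cf_der, ih]
    congr 2; omega

lemma der_int : derOp K * intOp K = 1 := by
  apply LinearMap.ext; intro f
  apply cf_ext; intro m
  rw [Module.End.mul_apply, cf_der, cf_int_succ]; rfl

lemma der_x : derOp K * xOp K - xOp K * derOp K = 1 := by
  apply LinearMap.ext; intro f
  show derivative (X * f) - X * derivative f = f
  rw [derivative_mul]; simp

lemma e_apply (f : K[X]) : (1 - intOp K * derOp K) f = cf K 0 f • bb K 0 := by
  apply cf_ext
  intro m
  rw [LinearMap.sub_apply, map_sub, Module.End.mul_apply, map_smul, cf_bb]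
  cases m with
  | zero => rw [cf_int_zero]; simp
  | succ m => rw [cf_int_succ, cf_der]; simp

/-- `T` is eventually banded with polynomial coefficients. -/
def BRep (T : Module.End K K[X]) (p : ℤ → K[X]) (d N : ℕ) : Prop :=
  (∀ k : ℤ, d < k.natAbs → p k = 0) ∧
  ∀ n m : ℕ, N ≤ n → cf K m (T (bb K n)) = (p ((m : ℤ) - n)).eval (n : K)

/-- the class of such operators -/
def IsRep (T : Module.End K K[X]) : Prop := ∃ p d N, BRep K T p d N

lemma IsRep.one : IsRep K 1 := by
  refine ⟨fun k => if k = 0 then 1 else 0, 0, 0, ?_, ?_⟩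
  · intro k hk
    have : k ≠ 0 := by rintro rfl; simp at hk
    simp [this]
  · intro n m _
    show cf K m (bb K n) = _
    rw [cf_bb]
    by_cases h : m = n
    · simp [h]
    · have : (m : ℤ) - n ≠ 0 := by omega
      simp [h, this]

lemma IsRep.add {S T : Module.End K K[X]} (hS : IsRep K S) (hT : IsRep K T) :
    IsRep K (S + T) := by
  obtain ⟨p, d, N, h1, h2⟩ := hS
  obtain ⟨q, e, M, h3, h4⟩ := hT
  refine ⟨fun k => p k + q k, d + e, N + M, ?_, ?_⟩
  · intro k hk
    simp only
    rw [h1 k (by omega), h3 k (by omega), add_zero]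
  · intro n m hn
    rw [LinearMap.add_apply, map_add, h2 n m (by omega), h4 n m (by omega), eval_add]

lemma IsRep.smul (c : K) {T : Module.End K K[X]} (hT : IsRep K T) : IsRep K (c • T) := by
  obtain ⟨p, d, N, h1, h2⟩ := hT
  refine ⟨fun k => C c * p k, d, N, ?_, ?_⟩
  · intro k hk
    simp only
    rw [h1 k hk, mul_zero]
  · intro n m hn
    rw [LinearMap.smul_apply, map_smul, h2 n m hn]
    simp

lemma IsRep.der {T : Module.End K K[X]} (hT : IsRep K T) : IsRep K (derOp K * T) := by
  obtain ⟨p, d, N, h1, h2⟩ := hT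
  refine ⟨fun k => p (k + 1), d + 1, N, ?_, ?_⟩
  · intro k hk
    exact h1 _ (by omega)
  · intro n m hn
    rw [Module.End.mul_apply, cf_der, h2 n _ hn]
    congr 2; push_cast; ring

lemma IsRep.int {T : Module.End K K[X]} (hT : IsRep K T) : IsRep K (intOp K * T) := by
  obtain ⟨p, d, N, h1, h2⟩ := hT
  refine ⟨fun k => p (k - 1), d + 1, N + d, ?_, ?_⟩
  · intro k hk
    exact h1 _ (by omega)
  · intro n m hn
    rw [Module.End.mul_apply]
    cases m with
    | zero =>
      rw [cf_int_zero]
      simp only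
      rw [h1 _ (by push_cast; omega), eval_zero]
    | succ m =>
      rw [cf_int_succ, h2 n _ (by omega)]
      congr 2; push_cast; ring

lemma IsRep.x {T : Module.End K K[X]} (hT : IsRep K T) : IsRep K (xOp K * T) := by
  obtain ⟨p, d, N, h1, h2⟩ := hT
  refine ⟨fun k => (X + C (k : K)) * p (k - 1), d + 1, N + d, ?_, ?_⟩
  · intro k hk
    simp only
    rw [h1 _ (by omega), mul_zero]
  · intro n m hn
    rw [Module.End.mul_apply]
    cases m with
    | zero =>
      rw [cf_x_zero]
      simp only
      rw [h1 _ (by push_cast; omega), mul_zero, eval_zero]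
    | succ m =>
      rw [cf_x_succ, h2 n _ (by omega)]
      have : ((m + 1 : ℕ) : ℤ) - n - 1 = (m : ℤ) - n := by push_cast; ring
      simp only [this]
      simp

/-- left multipliers -/
def mulSub : Subalgebra K (Module.End K K[X]) where
  carrier := {S | ∀ T, IsRep K T → IsRep K (S * T)}
  mul_mem' := by
    intro a b ha hb T hT
    rw [mul_assoc]
    exact ha _ (hb _ hT)
  add_mem' := by
    intro a b ha hb T hT
    rw [add_mul]
    exact (ha _ hT).add K (hb _ hT)
  algebraMap_mem' := by
    intro r T hT
    rw [← Algebra.smul_def]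
    exact hT.smul K r

lemma isRep_of_mem {T : Module.End K K[X]} (hT : T ∈ I1 K) : IsRep K T := by
  have h : I1 K ≤ mulSub K := by
    apply Algebra.adjoin_le
    rintro S (rfl | rfl | rfl) T hT
    · exact hT.x K
    · exact hT.der K
    · exact hT.int K
  simpa using h hT 1 (IsRep.one K)

lemma BRep.expand {T : Module.End K K[X]} {p : ℤ → K[X]} {d N : ℕ} (h : BRep K T p d N)
    {n : ℕ} (hn : N ≤ n) (hd : d ≤ n) :
    T (bb K n) = ∑ j ∈ Finset.Icc (-(d : ℤ)) d, (p j).eval (n : K) • bb K ((n : ℤ) + j).toNat := by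
  apply cf_ext
  intro m
  rw [h.2 n m hn, map_sum]
  simp only [map_smul, cf_bb, smul_eq_mul]
  rw [Finset.sum_eq_single ((m : ℤ) - n)]
  · simp
  · intro j hj hne
    rw [Finset.mem_Icc] at hj
    rw [if_neg (by omega), mul_zero]
  · intro hj
    rw [Finset.mem_Icc] at hj
    rw [h.1 _ (by omega)]
    simp

lemma BRep.mul {S T : Module.End K K[X]} {p q : ℤ → K[X]} {d e N M : ℕ} (hS : BRep K S p d N)
    (hT : BRep K T q e M) {n : ℕ} (hn : N + M + e ≤ n) (l : ℕ) :
    cf K l ((S * T) (bb K n)) = ∑ j ∈ Finset.Icc (-(e : ℤ)) e,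
      (q j).eval (n : K) * (p ((l : ℤ) - n - j)).eval ((n : K) + (j : K)) := by
  rw [Module.End.mul_apply, hT.expand K (by omega) (by omega), map_sum, map_sum]
  apply Finset.sum_congr rfl
  intro j hj
  rw [Finset.mem_Icc] at hj
  rw [map_smul, map_smul, hS.2 _ _ (by omega), smul_eq_mul]
  have h1 : (((n : ℤ) + j).toNat : ℤ) = n + j := by omega
  have h2 : ((((n : ℤ) + j).toNat : ℕ) : K) = (n : K) + (j : K) := by
    have := congrArg (Int.cast : ℤ → K) h1
    push_cast at this
    simpa using this
  rw [h1, h2]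
  congr 3; ring

lemma exists_large_ne {f : K[X]} (hf : f ≠ 0) (N : ℕ) : ∃ n ≥ N, f.eval (n : K) ≠ 0 := by
  by_contra hcon
  push Not at hcon
  apply hf
  apply Polynomial.eq_zero_of_infinite_isRoot
  have : Set.Infinite ((fun n : ℕ => (n : K)) '' Set.Ici N) :=
    (Set.Ici_infinite N).image (Nat.cast_injective.injOn)
  apply this.mono
  rintro _ ⟨n, hn, rfl⟩
  exact hcon n hn

lemma top_nonneg {T : Module.End K K[X]} (hinj : Function.Injective T) {p : ℤ → K[X]} {d N : ℕ}
    (h : BRep K T p d N) {a : ℤ} (ha : ∀ k, a < k → p k = 0) : 0 ≤ a := by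
  by_contra hneg
  push Not at hneg
  obtain ⟨B, hB⟩ : ∃ B : ℕ, ∀ n < N, (T (X ^ n)).natDegree < B := by
    refine ⟨(∑ n ∈ Finset.range N, (T (X ^ n)).natDegree) + 1, fun n hn => ?_⟩
    have := Finset.single_le_sum (f := fun n => (T (X ^ n)).natDegree)
      (fun _ _ => Nat.zero_le _) (Finset.mem_range.2 hn)
    omega
  classical
  have hmap : ∀ f ∈ degreeLT K (B + N + 1), T f ∈ degreeLT K (B + N) := by
    change degreeLT K (B + N + 1) ≤ (degreeLT K (B + N)).comap T
    rw [← Submodule.map_le_iff_le_comap, degreeLT_eq_span_X_pow,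
      Submodule.map_span, Submodule.span_le]
    rintro _ ⟨_, hx, rfl⟩
    simp only [Finset.coe_image, Finset.coe_range, Set.mem_image, Set.mem_Iio] at hx
    obtain ⟨n, hn, rfl⟩ := hx
    show T (X ^ n) ∈ degreeLT K (B + N)
    rw [mem_degreeLT, degree_lt_iff_coeff_zero]
    intro m hm
    by_cases hnN : n < N
    · exact coeff_eq_zero_of_natDegree_lt (by have := hB n hnN; omega)
    · have h1 := h.2 n m (by omega)
      rw [ha _ (by omega), eval_zero, cf_apply] at h1
      have h2 : (X ^ n : K[X]) = (n.factorial : K) • bb K n := by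
        rw [bb, smul_monomial, smul_eq_mul, mul_inv_cancel₀ (fac_ne K n), monomial_one_right_eq_X_pow]
      rw [h2, map_smul, coeff_smul, (mul_eq_zero.1 h1).resolve_left (fac_ne K m), smul_zero]
  have hle := LinearMap.finrank_le_finrank_of_injective
    (f := LinearMap.restrict T hmap) (by
      intro x y hxy
      apply Subtype.ext
      apply hinj
      exact congrArg Subtype.val hxy)
  rw [(degreeLTEquiv K (B + N + 1)).finrank_eq, (degreeLTEquiv K (B + N)).finrank_eq] at hle
  simp at hle

lemma BRep.ne_zero {T : Module.End K K[X]} (hinj : Function.Injective T) {p : ℤ → K[X]} {d N : ℕ}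
    (h : BRep K T p d N) : ∃ k, p k ≠ 0 := by
  by_contra hcon
  push Not at hcon
  have := top_nonneg K hinj h (a := -1) (fun k _ => hcon k)
  omega

lemma BRep.exists_top {T : Module.End K K[X]} (hinj : Function.Injective T) {p : ℤ → K[X]}
    {d N : ℕ} (h : BRep K T p d N) : ∃ a, p a ≠ 0 ∧ ∀ k, a < k → p k = 0 := by
  obtain ⟨a, h1, h2⟩ := Int.exists_greatest_of_bdd (P := fun k => p k ≠ 0)
    ⟨d, fun z hz => by
      by_contra hlt
      exact hz (h.1 z (by omega))⟩ (h.ne_zero K hinj)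
  refine ⟨a, h1, fun k hk => ?_⟩
  by_contra hne
  have := h2 k hne
  omega

lemma BRep.exists_bot {T : Module.End K K[X]} (hinj : Function.Injective T) {p : ℤ → K[X]}
    {d N : ℕ} (h : BRep K T p d N) : ∃ a, p a ≠ 0 ∧ ∀ k, k < a → p k = 0 := by
  obtain ⟨a, h1, h2⟩ := Int.exists_least_of_bdd (P := fun k => p k ≠ 0)
    ⟨-d, fun z hz => by
      by_contra hlt
      exact hz (h.1 z (by omega))⟩ (h.ne_zero K hinj)
  refine ⟨a, h1, fun k hk => ?_⟩
  by_contra hne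
  have := h2 k hne
  omega

/-- extreme coefficients multiply -/
lemma extreme {S T : Module.End K K[X]} (hST : S * T = 1) {p q : ℤ → K[X]} {d e N M : ℕ}
    (hS : BRep K S p d N) (hT : BRep K T q e M) {a b : ℤ} (ha : p a ≠ 0) (hb : q b ≠ 0)
    (hab : ∀ j, j ≠ b → q j = 0 ∨ p (a + b - j) = 0) : a + b = 0 := by
  by_contra hne
  have hcomp : (p a).comp (X + C (b : K)) ≠ 0 := by
    intro h0
    apply ha
    have := congrArg (fun f => f.comp (X - C (b : K))) h0
    simpa [comp_assoc] using this
  obtain ⟨n, hn, hev⟩ := exists_large_ne K (mul_ne_zero hb hcomp)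
    (N + M + e + (a + b).natAbs)
  have h1 := hS.mul K hT (n := n) (by omega) ((n : ℤ) + a + b).toNat
  have h3 : ((((n : ℤ) + a + b).toNat : ℕ) : ℤ) = n + a + b := by omega
  rw [hST, Module.End.one_apply, cf_bb, if_neg (by omega), h3] at h1
  rw [Finset.sum_eq_single b] at h1
  · apply hev
    rw [show (n : ℤ) + a + b - n - b = a by ring] at h1
    rw [eval_mul, eval_comp, h1]
    simp
  · intro j _ hj
    rcases hab j hj with h | h
    · simp [h]
    · rw [show (n : ℤ) + a + b - n - j = a + b - j by ring, h]; simp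
  · intro hb'
    rw [Finset.mem_Icc] at hb'
    exact absurd (hT.1 b (by omega)) hb

lemma no_weyl {u v y : Module.End K K[X]} (hu : IsRep K u) (hv : IsRep K v) (hy : IsRep K y)
    (huv : u * v = 1) (hvu : v * u = 1) (hc : u * y - y * u = 1) : False := by
  obtain ⟨p, d, N, hp⟩ := hu
  obtain ⟨q, e, M, hq⟩ := hv
  obtain ⟨r, g, L, hr⟩ := hy
  have iu : Function.Injective u := by
    apply Function.LeftInverse.injective (g := v)
    intro f
    exact LinearMap.congr_fun hvu f
  have iv : Function.Injective v := by
    apply Function.LeftInverse.injective (g := u)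
    intro f
    exact LinearMap.congr_fun huv f
  obtain ⟨a, ha, ha'⟩ := hp.exists_top K iu
  obtain ⟨b, hb, hb'⟩ := hq.exists_top K iv
  obtain ⟨s, hs, hs'⟩ := hp.exists_bot K iu
  obtain ⟨t, ht, ht'⟩ := hq.exists_bot K iv
  have ha0 := top_nonneg K iu hp ha'
  have hb0 := top_nonneg K iv hq hb'
  have h1 := extreme K huv hp hq ha hb (fun j hj => by
    rcases lt_or_gt_of_ne hj with h | h
    · exact Or.inr (ha' _ (by omega))
    · exact Or.inl (hb' _ h))
  have h2 := extreme K huv hp hq hs ht (fun j hj => by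
    rcases lt_or_gt_of_ne hj with h | h
    · exact Or.inl (ht' _ h)
    · exact Or.inr (hs' _ (by omega)))
  have hsa : s ≤ a := by
    by_contra h
    exact hs (ha' _ (by omega))
  have htb : t ≤ b := by
    by_contra h
    exact ht (hb' _ (by omega))
  have hp0 : ∀ k, k ≠ 0 → p k = 0 := by
    intro k hk
    rcases lt_or_gt_of_ne hk with h | h
    · exact hs' _ (by omega)
    · exact ha' _ (by omega)
  have e1 := hp.mul K hr (n := N + L + g + d) (by omega) (N + L + g + d)
  have e2 := hr.mul K hp (n := N + L + g + d) (by omega) (N + L + g + d)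
  rw [Finset.sum_eq_single 0] at e1 e2
  · have e3 := congrArg (fun F => cf K (N + L + g + d) (F (bb K (N + L + g + d)))) hc
    simp only [LinearMap.sub_apply, map_sub, Module.End.one_apply, cf_bb] at e3
    rw [e1, e2] at e3
    simp at e3
    rw [mul_comm, sub_self] at e3
    exact zero_ne_one e3
  · intro j _ hj
    rw [hp0 j hj]; simp
  · simp
  · intro j _ hj
    rw [hp0 _ (by omega)]; simp
  · simp

lemma sandwich (T : Module.End K K[X]) (m n : ℕ) :
    (1 - intOp K * derOp K) * derOp K ^ m * T * intOp K ^ n * (1 - intOp K * derOp K)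
      = cf K m (T (bb K n)) • (1 - intOp K * derOp K) := by
  apply LinearMap.ext; intro f
  simp only [Module.End.mul_apply, LinearMap.smul_apply]
  rw [e_apply, e_apply, map_smul, map_smul, map_smul, map_smul, int_pow_bb, cf_der_pow, zero_add,
    smul_smul, smul_eq_mul, mul_comm]

/-- Every `K`-algebra endomorphism of `I₁` is injective. -/
theorem every_algEndomorphism_of_I1_is_injective (σ : I1 K →ₐ[K] I1 K) :
    Function.Injective σ := by
  rw [injective_iff_map_eq_zero]
  intro T hT
  by_contra hne
  obtain ⟨n, m, hnm⟩ : ∃ n m, cf K m (T.1 (bb K n)) ≠ 0 := by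
    by_contra hcon
    push Not at hcon
    apply hne
    apply Subtype.ext
    apply Polynomial.lhom_ext'
    intro n
    apply LinearMap.ext_ring
    have h2 : (monomial n (1 : K) : K[X]) = (n.factorial : K) • bb K n := by
      rw [bb, smul_monomial, smul_eq_mul, mul_inv_cancel₀ (fac_ne K n)]
    show T.1 (monomial n (1 : K)) = 0
    rw [h2, map_smul]
    have : T.1 (bb K n) = 0 := cf_ext K (fun m => by rw [hcon n m, map_zero])
    rw [this, smul_zero]
  have hsub : ∀ a b : I1 K, σ (a - b) = σ a - σ b := fun a b => map_sub σ a b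
  let XI : I1 K := ⟨xOp K, xOp_mem K⟩
  have hsand : (1 - IntI K * DelI K) * DelI K ^ m * T * IntI K ^ n * (1 - IntI K * DelI K)
      = cf K m (T.1 (bb K n)) • (1 - IntI K * DelI K) := Subtype.ext (sandwich K T.1 m n)
  have h0 : cf K m (T.1 (bb K n)) • (1 - σ (IntI K) * σ (DelI K)) = 0 := by
    have := congrArg σ hsand
    simp only [map_mul, hT, map_smul, hsub, map_one, mul_zero, zero_mul] at this
    exact this.symm
  have h1 : σ (IntI K) * σ (DelI K) = 1 :=
    (sub_eq_zero.1 ((smul_eq_zero.1 h0).resolve_left hnm)).symm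
  have h2 : σ (DelI K) * σ (IntI K) = 1 := by
    rw [← map_mul, show DelI K * IntI K = 1 from Subtype.ext (der_int K), map_one]
  have h3 : σ (DelI K) * σ XI - σ XI * σ (DelI K) = 1 := by
    rw [← map_mul, ← map_mul, ← hsub,
      show DelI K * XI - XI * DelI K = 1 from Subtype.ext (der_x K), map_one]
  exact no_weyl K (isRep_of_mem K (σ (DelI K)).2) (isRep_of_mem K (σ (IntI K)).2)
    (isRep_of_mem K (σ XI).2) (congrArg Subtype.val h2) (congrArg Subtype.val h1)
    (congrArg Subtype.val h3)


end
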